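/- Let T be a finite rooted tree with vertex set A (abscissas) and root ρ. The number of pairs (Cayley tree C on {1,...,n} with a root, morphism a: C → T sending root to ρ and adjacent vertices to adjacent vertices) that are surjective with prescribed profile (n_i)_{i∈A} (all n_i > 0, Σ n_i = n) equals n_ρ · (n!/∏_{i∈A} n_i!) · ∏_{i∈A} ((Σ_{j ~ i} n_j)^{n_i - 1} · n_i^{deg(i) - 1}), where j ~ i means j adjacent to i in T and deg(i) is the degree of i in T. -/

import Mathlib

/-- parent functions rooted at r -/
def GoodF {V : Type*} (r : V) (f : V → V) : Prop :=
  f r = r ∧ ∃ h : V → ℕ, ∀ v, v ≠ r → h (f v) < h v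

theorem goodF_of_reach {V : Type*} (r : V) (f : V → V) (hr : f r = r)
    (H : ∀ v, ∃ k, f^[k] v = r) : GoodF r f := by
  classical
  refine ⟨hr, fun v => Nat.find (H v), fun v hv => ?_⟩
  have hs := Nat.find_spec (H v)
  have hpos : Nat.find (H v) ≠ 0 := by
    intro h0
    rw [h0] at hs
    exact hv hs
  obtain ⟨k, hk⟩ := Nat.exists_eq_succ_of_ne_zero hpos
  rw [hk, Function.iterate_succ_apply] at hs
  have := Nat.find_min' (H (f v)) hs
  change Nat.find (H (f v)) < Nat.find (H v)
  omega

theorem det_good {V : Type*} [Fintype V] [DecidableEq V] (r : V) (f : V → V)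
    (hf : GoodF r f) :
    (Matrix.of fun v u : V => if v = r then (if u = r then (1:ℚ) else 0) else
      (if v = u then 1 else 0) - (if f v = u then 1 else 0)).det = 1 := by
  obtain ⟨hr, h, hh⟩ := hf
  rw [Matrix.BlockTriangular.det (b := fun v => OrderDual.toDual (h v))]
  · apply Finset.prod_eq_one
    intro a _
    refine (congrArg Matrix.det ?_).trans Matrix.det_one
    ext ⟨i, hi⟩ ⟨j, hj⟩
    simp only [Matrix.toSquareBlock_def, Matrix.of_apply, Matrix.one_apply, Subtype.mk.injEq]
    have hij : h i = h j := by
      have := hi.trans hj.symm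
      simpa using this
    by_cases h1 : i = r
    · subst h1
      simp [eq_comm]
    · have : f i ≠ j := by
        intro h2
        have := hh i h1
        rw [h2] at this; omega
      simp [h1, this]
  · intro i j hij
    have hij : h i < h j := hij
    have h0 : i ≠ j := by rintro rfl; omega
    simp only [Matrix.of_apply]
    by_cases h1 : i = r
    · subst h1
      simp [h0.symm]
    · have : f i ≠ j := by
        intro h2
        have := hh i h1
        rw [h2] at this; omega
      simp [h1, h0, this]

theorem det_bad {V : Type*} [Fintype V] [DecidableEq V] (r : V) (f : V → V) (hr : f r = r)
    (hf : ¬ GoodF r f) :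
    (Matrix.of fun v u : V => if v = r then (if u = r then (1:ℚ) else 0) else
      (if v = u then 1 else 0) - (if f v = u then 1 else 0)).det = 0 := by
  classical
  by_contra hne
  apply hf
  apply goodF_of_reach r f hr
  by_contra! hcon
  obtain ⟨v0, hv0⟩ := hcon
  apply hne
  rw [← Matrix.exists_mulVec_eq_zero_iff]
  refine ⟨fun v => if ∀ k, f^[k] v ≠ r then 1 else 0, ?_, ?_⟩
  · intro h0
    have := congrFun h0 v0
    simp [hv0] at this
  · ext v
    simp only [Matrix.mulVec, dotProduct, Matrix.of_apply, Pi.zero_apply]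
    by_cases h1 : v = r
    · subst h1
      simp only [if_true]
      apply Finset.sum_eq_zero
      intro u _
      by_cases h2 : u = v
      · subst h2
        have : ¬ ∀ k, f^[k] u ≠ u := by push Not; exact ⟨0, rfl⟩
        simp only [this]; simp
      · simp [h2]
    · simp only [h1, if_false, sub_mul, Finset.sum_sub_distrib, ite_mul, one_mul, zero_mul,
        Finset.sum_ite_eq, Finset.mem_univ, if_true]
      have : (∀ k, f^[k] v ≠ r) ↔ (∀ k, f^[k] (f v) ≠ r) := by
        constructor
        · intro h k; exact h (k+1)
        · intro h k
          cases k with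
          | zero => exact h1
          | succ k => exact h k
      simp only [this, sub_self]

open Classical in
theorem mtt {V : Type*} [Fintype V] [DecidableEq V] (r : V) (w : V → V → ℚ) :
    (Matrix.of fun v u : V => if v = r then (if u = r then (1:ℚ) else 0) else
      (if v = u then ∑ x, w v x else 0) - w v u).det =
    ∑ f : V → V with GoodF r f, ∏ v ∈ Finset.univ.erase r, w v (f v) := by
  set w' : V → V → ℚ := fun v x => if v = r then (if x = r then 1 else 0) else w v x with hw'
  have h1 : (Matrix.of fun v u : V => if v = r then (if u = r then (1:ℚ) else 0) else
      (if v = u then ∑ x, w v x else 0) - w v u) =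
      (fun v => ∑ x, w' v x • (fun u => if v = r then (if u = r then (1:ℚ) else 0) else
      (if v = u then 1 else 0) - (if x = u then 1 else 0))) := by
    ext v u
    simp only [Matrix.of_apply, Finset.sum_apply, Pi.smul_apply, smul_eq_mul, hw']
    by_cases h : v = r
    · simp [h]
    · simp [h, mul_sub, Finset.sum_sub_distrib]
  rw [h1]
  have h2 := (Matrix.detRowAlternating (R := ℚ) (n := V)).toMultilinearMap.map_sum
    (fun v x => w' v x • (fun u => if v = r then (if u = r then (1:ℚ) else 0) else
      (if v = u then 1 else 0) - (if x = u then 1 else 0)))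
  refine (h2.trans ?_)
  rw [Finset.sum_filter]
  refine Finset.sum_congr rfl fun f _ => ?_
  rw [MultilinearMap.map_smul_univ]
  have h3 : ∏ v, w' v (f v) = (if f r = r then 1 else 0) * ∏ v ∈ Finset.univ.erase r, w v (f v) := by
    rw [← Finset.mul_prod_erase _ _ (Finset.mem_univ r)]
    congr 1
    · simp [hw']
    · apply Finset.prod_congr rfl
      intro v hv
      simp [hw', Finset.ne_of_mem_erase hv]
  rw [h3]
  by_cases hr : f r = r
  · split_ifs with hg
    · have := det_good r f hg
      rw [one_mul]
      refine Eq.trans ?_ (mul_one _)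
      rw [smul_eq_mul]
      congr 1
    · have := det_bad r f hr hg
      rw [one_mul]
      refine Eq.trans ?_ (mul_zero (∏ v ∈ Finset.univ.erase r, w v (f v)))
      rw [smul_eq_mul]
      congr 1
  · have : ¬ GoodF r f := fun h => hr h.1
    simp [hr, this]

/-- graph of a parent function -/
def parentGraph {V : Type*} (f : V → V) : SimpleGraph V :=
  SimpleGraph.fromRel (fun v u => f v = u)

theorem parentGraph_adj {V : Type*} {r : V} {f : V → V} (hf : GoodF r f) (v u : V) :
    (parentGraph f).Adj v u ↔ (v ≠ r ∧ f v = u) ∨ (u ≠ r ∧ f u = v) := by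
  obtain ⟨hr, h, hh⟩ := hf
  rw [parentGraph, SimpleGraph.fromRel_adj]
  constructor
  · rintro ⟨hne, h1 | h1⟩
    · left; refine ⟨?_, h1⟩
      rintro rfl; exact hne (hr.symm.trans h1)
    · right; refine ⟨?_, h1⟩
      rintro rfl; exact hne (h1.symm.trans hr)
  · rintro (⟨h0, h1⟩ | ⟨h0, h1⟩)
    · refine ⟨?_, Or.inl h1⟩
      rintro rfl
      have := hh v h0; rw [h1] at this; omega
    · refine ⟨?_, Or.inr h1⟩
      rintro rfl
      have := hh v h0; rw [h1] at this; omega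

theorem parentGraph_connected {V : Type*} {r : V} {f : V → V} (hf : GoodF r f) :
    (parentGraph f).Connected := by
  have hadj := parentGraph_adj hf
  obtain ⟨hr, h, hh⟩ := hf
  have key : ∀ m v, h v ≤ m → (parentGraph f).Reachable v r := by
    intro m
    induction m with
    | zero =>
      intro v hv
      by_cases h1 : v = r
      · rw [h1]
      · have := hh v h1; omega
    | succ m ih =>
      intro v hv
      by_cases h1 : v = r
      · rw [h1]
      · have := hh v h1
        have h2 : (parentGraph f).Adj v (f v) := (hadj _ _).2 (Or.inl ⟨h1, rfl⟩)
        exact h2.reachable.trans (ih _ (by omega))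
  have : Nonempty V := ⟨r⟩
  exact ⟨fun u v => (key _ u le_rfl).trans (key _ v le_rfl).symm⟩

theorem parentGraph_isTree {V : Type*} [Finite V] {r : V} {f : V → V} (hf : GoodF r f) :
    (parentGraph f).IsTree := by
  classical
  have := Fintype.ofFinite V
  rw [SimpleGraph.isTree_iff_connected_and_card]
  refine ⟨parentGraph_connected hf, le_antisymm ?_
    (parentGraph_connected hf).card_vert_le_card_edgeSet_add_one⟩
  have hsub : (parentGraph f).edgeSet ⊆
      (((Finset.univ.erase r).image (fun v => s(v, f v)) : Finset (Sym2 V)) : Set (Sym2 V)) := by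
    intro e
    induction e with
    | h x y =>
      rw [SimpleGraph.mem_edgeSet, parentGraph_adj hf]
      rintro (⟨h0, h1⟩ | ⟨h0, h1⟩)
      · simp only [Finset.coe_image, Set.mem_image]
        exact ⟨x, by simp [h0], by rw [h1]⟩
      · simp only [Finset.coe_image, Set.mem_image]
        exact ⟨y, by simp [h0], by rw [h1, Sym2.eq_swap]⟩
  have h1 := Set.ncard_le_ncard hsub (Finset.finite_toSet _)
  rw [Set.ncard_coe_finset] at h1
  have h2 := (Finset.card_image_le (s := Finset.univ.erase r) (f := fun v => s(v, f v)))
  rw [Finset.card_erase_of_mem (Finset.mem_univ r), Finset.card_univ] at h2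
  have h3 : 0 < Fintype.card V := Fintype.card_pos_iff.2 ⟨r⟩
  rw [Nat.card_eq_fintype_card (α := V), Nat.card_coe_set_eq]
  omega

theorem parentGraph_inj {V : Type*} {r : V} {f g : V → V} (hf : GoodF r f)
    (hg : GoodF r g) (heq : parentGraph f = parentGraph g) : f = g := by
  have hadjf := parentGraph_adj hf
  have hadjg := parentGraph_adj hg
  obtain ⟨hr, h, hh⟩ := hf
  have key : ∀ m v, h v ≤ m → f v = g v := by
    intro m
    induction m with
    | zero =>
      intro v hv
      by_cases h1 : v = r
      · rw [h1, hr, hg.1]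
      · have := hh v h1; omega
    | succ m ih =>
      intro v hv
      by_cases h1 : v = r
      · rw [h1, hr, hg.1]
      · have hlt := hh v h1
        have h2 : (parentGraph f).Adj v (f v) := (hadjf _ _).2 (Or.inl ⟨h1, rfl⟩)
        rw [heq, hadjg] at h2
        rcases h2 with ⟨_, h2⟩ | ⟨h3, h2⟩
        · exact h2.symm
        · exfalso
          have h4 := ih (f v) (by omega)
          have h5 := hh (f v) h3
          rw [h4, h2] at h5
          omega
  funext v
  exact key _ v le_rfl

theorem exists_parent {V : Type*} (r : V) (G : SimpleGraph V) (hG : G.IsTree) :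
    ∃ f, GoodF r f ∧ parentGraph f = G := by
  classical
  have hex : ∀ v, ∃ u, (v = r → u = r) ∧ (v ≠ r → G.Adj v u ∧ G.dist r u < G.dist r v) := by
    intro v
    by_cases h1 : v = r
    · exact ⟨r, fun _ => rfl, fun h => absurd h1 h⟩
    · obtain ⟨p, hp⟩ := hG.connected.exists_walk_length_eq_dist v r
      cases p with
      | nil => exact absurd rfl h1
      | @cons _ u _ hadj q =>
        refine ⟨u, fun h => absurd h h1, fun _ => ⟨hadj, ?_⟩⟩
        rw [SimpleGraph.dist_comm, SimpleGraph.dist_comm (u := r)]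
        have := SimpleGraph.dist_le q
        rw [SimpleGraph.Walk.length_cons] at hp
        omega
  choose f hf1 hf2 using hex
  have hg : GoodF r f := ⟨hf1 r rfl, fun v => G.dist r v, fun v hv => (hf2 v hv).2⟩
  refine ⟨f, hg, ?_⟩
  have hle : parentGraph f ≤ G := by
    intro v u hvu
    rcases (parentGraph_adj hg v u).1 hvu with ⟨h0, h1⟩ | ⟨h0, h1⟩
    · rw [← h1]; exact (hf2 v h0).1
    · rw [← h1]; exact (hf2 u h0).1.symm
  exact le_antisymm hle ((SimpleGraph.isTree_iff_minimal_connected.1 hG).2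
    (parentGraph_connected hg) hle)

theorem parentGraph_le {V : Type*} {r : V} {f : V → V} (hf : GoodF r f) (H : SimpleGraph V) :
    parentGraph f ≤ H ↔ ∀ v, v ≠ r → H.Adj v (f v) := by
  constructor
  · intro h v hv
    exact h ((parentGraph_adj hf _ _).2 (Or.inl ⟨hv, rfl⟩))
  · intro h v u hvu
    rcases (parentGraph_adj hf v u).1 hvu with ⟨h0, h1⟩ | ⟨h0, h1⟩
    · rw [← h1]; exact (h v h0)
    · rw [← h1]; exact (h u h0).symm

open Classical in
theorem card_trees {V : Type*} [Fintype V] [DecidableEq V] (r : V) (H : SimpleGraph V) :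
    ((Finset.univ.filter fun G : SimpleGraph V => G.IsTree ∧ G ≤ H).card : ℚ) =
    ∑ f : V → V with GoodF r f, ∏ v ∈ Finset.univ.erase r, (if H.Adj v (f v) then 1 else 0) := by
  have h1 : ∀ f : V → V, GoodF r f →
      (∏ v ∈ Finset.univ.erase r, (if H.Adj v (f v) then (1:ℚ) else 0)) =
        if parentGraph f ≤ H then 1 else 0 := by
    intro f hf
    rw [Finset.prod_ite_zero, parentGraph_le hf]
    simp
  rw [Finset.sum_congr rfl fun f hf => h1 f (Finset.mem_filter.1 hf).2, Finset.sum_boole,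
    Finset.filter_filter]
  congr 1
  symm
  apply Finset.card_bij (fun f _ => parentGraph f)
  · intro f hf
    simp only [Finset.mem_filter, Finset.mem_univ, true_and] at hf ⊢
    exact ⟨parentGraph_isTree hf.1, hf.2⟩
  · intro f hf g hg he
    simp only [Finset.mem_filter, Finset.mem_univ, true_and] at hf hg
    exact parentGraph_inj hf.1 hg.1 he
  · intro G hG
    simp only [Finset.mem_filter, Finset.mem_univ, true_and] at hG
    obtain ⟨f, hf, rfl⟩ := exists_parent r G hG.1
    exact ⟨f, by simp [hf, hG.2], rfl⟩

open Classical in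
/-- The weighted sum over a tree. -/
theorem weighted_tree {A : Type*} [Fintype A] [DecidableEq A]
    (T : SimpleGraph A) [DecidableRel T.Adj] (hT : T.IsTree) (ρ : A) (n : A → ℚ) :
    (∑ f : A → A with GoodF ρ f, ∏ v ∈ Finset.univ.erase ρ, (if T.Adj v (f v) then n (f v) else 0))
      * ∏ i, n i = n ρ * ∏ i, n i ^ (T.neighborFinset i).card := by
  obtain ⟨f, hf, hfT⟩ := exists_parent ρ T hT
  have hadj : ∀ v u, T.Adj v u ↔ (v ≠ ρ ∧ f v = u) ∨ (u ≠ ρ ∧ f u = v) := by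
    intro v u; rw [← parentGraph_adj hf, hfT]
  rw [Finset.sum_eq_single f]
  · have h1 : ∏ v ∈ Finset.univ.erase ρ, (if T.Adj v (f v) then n (f v) else 0) =
        ∏ v ∈ Finset.univ.erase ρ, n (f v) := by
      apply Finset.prod_congr rfl
      intro v hv
      rw [if_pos ((hadj _ _).2 (Or.inl ⟨Finset.ne_of_mem_erase hv, rfl⟩))]
    rw [h1, ← Finset.mul_prod_erase _ n (Finset.mem_univ ρ)]
    have h2 : ∀ i, n i ^ (T.neighborFinset i).card =
        ∏ j, (if i ≠ ρ ∧ f i = j then n i else 1) * (if j ≠ ρ ∧ f j = i then n i else 1) := by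
      intro i
      rw [← Finset.prod_const, SimpleGraph.neighborFinset_eq_filter, Finset.prod_filter]
      apply Finset.prod_congr rfl
      intro j _
      have hexcl : ¬ ((i ≠ ρ ∧ f i = j) ∧ (j ≠ ρ ∧ f j = i)) := by
        rintro ⟨⟨a1, a2⟩, a3, a4⟩
        obtain ⟨_, h, hh⟩ := hf
        have b1 := hh i a1
        have b2 := hh j a3
        rw [a2] at b1; rw [a4] at b2; omega
      have := hadj i j
      by_cases c1 : i ≠ ρ ∧ f i = j
      · have c2 : ¬ (j ≠ ρ ∧ f j = i) := fun h => hexcl ⟨c1, h⟩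
        rw [if_pos (this.2 (Or.inl c1)), if_pos c1, if_neg c2, mul_one]
      · by_cases c2 : j ≠ ρ ∧ f j = i
        · rw [if_pos (this.2 (Or.inr c2)), if_neg c1, if_pos c2, one_mul]
        · rw [if_neg (by rw [this]; tauto), if_neg c1, if_neg c2, one_mul]
    have h3 : ∀ g : A → A → ℚ, (∏ i, ∏ j, if i ≠ ρ ∧ f i = j then g i j else 1) =
        ∏ i ∈ Finset.univ.erase ρ, g i (f i) := by
      intro g
      rw [← Finset.mul_prod_erase _ _ (Finset.mem_univ ρ)]
      simp only [ne_eq, not_true_eq_false, false_and, if_false, Finset.prod_const_one, one_mul]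
      apply Finset.prod_congr rfl
      intro i hi
      simp [Finset.ne_of_mem_erase hi]
    simp_rw [h2, Finset.prod_mul_distrib]
    rw [h3 (fun i _ => n i), Finset.prod_comm (f := fun i j => if j ≠ ρ ∧ f j = i then n i else 1),
      h3 (fun _ j => n j)]
    ring
  · intro g hg hne
    simp only [Finset.mem_filter, Finset.mem_univ, true_and] at hg
    by_contra h0
    apply hne
    apply parentGraph_inj hg hf
    rw [hfT]
    have hle : parentGraph g ≤ T := by
      rw [parentGraph_le hg]
      intro v hv
      by_contra h1
      exact h0 (Finset.prod_eq_zero (Finset.mem_erase.2 ⟨hv, Finset.mem_univ v⟩) (if_neg h1))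
    exact le_antisymm hle ((SimpleGraph.isTree_iff_minimal_connected.1 hT).2
      (parentGraph_connected hg) hle)
  · intro h; simp [hf] at h

theorem detA {A : Type*} [Fintype A] [DecidableEq A]
    (T : SimpleGraph A) [DecidableRel T.Adj] (hT : T.IsTree) (ρ : A) (n : A → ℚ)
    (hn : n ρ ≠ 0) :
    (Matrix.of fun i j : A => (if i = j then ∑ x, (if T.Adj i x then n x else 0) else 0) -
      (if T.Adj i j then n j - (if j = ρ then 1 else 0) else 0)).det * ∏ i, n i =
    (∑ x, (if T.Adj ρ x then n x else 0)) * ∏ i, n i ^ (T.neighborFinset i).card := by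
  classical
  set d : A → ℚ := fun i => ∑ x, (if T.Adj i x then n x else 0) with hd
  set M : Matrix A A ℚ := Matrix.of fun i j : A => (if i = j then d i else 0) -
      (if T.Adj i j then n j - (if j = ρ then 1 else 0) else 0) with hM
  have h1 := Matrix.det_updateRow_sum M ρ n
  have h2 : ∑ k, n k • M k = d ρ • (fun j => if j = ρ then (1:ℚ) else 0) := by
    ext j
    simp only [Finset.sum_apply, Pi.smul_apply, smul_eq_mul, hM, Matrix.of_apply, mul_sub,
      Finset.sum_sub_distrib]
    have e1 : ∑ i, n i * (if i = j then d i else 0) = n j * d j := by simp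
    have e2 : ∑ i, n i * (if T.Adj i j then n j - (if j = ρ then 1 else 0) else 0) =
        d j * (n j - (if j = ρ then 1 else 0)) := by
      rw [hd, Finset.sum_mul]
      apply Finset.sum_congr rfl
      intro i _
      simp only [T.adj_comm i j]
      split_ifs <;> ring
    rw [e1, e2]
    by_cases hj : j = ρ
    · subst hj; simp; ring
    · simp [hj]; ring
  rw [h2, Matrix.det_updateRow_smul] at h1
  have h3 := mtt ρ (fun i j => if T.Adj i j then n j else 0)
  have h4 := weighted_tree T hT ρ n
  rw [← h3] at h4
  have h5 : (M.updateRow ρ (fun j => if j = ρ then (1:ℚ) else 0)).det =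
      (Matrix.of fun v u : A => if v = ρ then (if u = ρ then (1:ℚ) else 0) else
      (if v = u then ∑ x, (if T.Adj v x then n x else 0) else 0) -
        (if T.Adj v u then n u else 0)).det := by
    apply Matrix.det_eq_of_forall_row_eq_smul_add_const
      (fun i => if T.Adj i ρ then 1 else 0) ρ (by simp)
    intro i j
    by_cases hi : i = ρ
    · subst hi; simp
    · rw [Matrix.updateRow_ne hi]
      simp only [hM, hd, Matrix.of_apply, hi, if_false, if_true]
      by_cases hj : j = ρ
      · subst hj
        by_cases ha : T.Adj i j
        · simp [ha, hi]; ring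
        · simp [ha]
      · simp [hj]
  rw [← h5] at h4
  simp only [smul_eq_mul] at h1
  apply mul_left_cancel₀ hn
  calc n ρ * (M.det * ∏ i, n i) = (n ρ * M.det) * ∏ i, n i := by ring
    _ = d ρ * ((M.updateRow ρ (fun j => if j = ρ then (1:ℚ) else 0)).det * ∏ i, n i) := by
      rw [← h1, mul_assoc]
    _ = _ := by rw [h4]; ring

theorem detV {A V : Type*} [Fintype A] [DecidableEq A] [Fintype V] [DecidableEq V]
    (T : SimpleGraph A) [DecidableRel T.Adj] (hT : T.IsTree) (ρ : A)
    (n : A → ℕ) (hpos : ∀ i, 0 < n i) (a : V → A) (r : V) (har : a r = ρ)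
    (hn : ∀ i, (Finset.univ.filter fun v => a v = i).card = n i) :
    (Matrix.of fun v u : V => if v = r then (if u = r then (1:ℚ) else 0) else
      (if v = u then ∑ x, (if T.Adj (a v) (a x) then (1:ℚ) else 0) else 0) -
        (if T.Adj (a v) (a u) then 1 else 0)).det * ∏ i, (n i : ℚ) =
    (∏ i, (∑ j ∈ T.neighborFinset i, (n j : ℚ)) ^ (n i - 1)) *
      ∏ i, (n i : ℚ) ^ (T.neighborFinset i).card := by
  classical
  rcases subsingleton_or_nontrivial A with hA | hA
  · have hadj : ∀ x y, ¬ T.Adj x y := fun x y h => h.ne (Subsingleton.elim _ _)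
    have hnb : ∀ i, T.neighborFinset i = ∅ := by
      intro i; ext j; simp [hadj]
    have hmat : (Matrix.of fun v u : V => if v = r then (if u = r then (1:ℚ) else 0) else
      (if v = u then ∑ x, (if T.Adj (a v) (a x) then (1:ℚ) else 0) else 0) -
        (if T.Adj (a v) (a u) then 1 else 0)) =
        Matrix.diagonal (fun v => if v = r then 1 else 0) := by
      ext v u
      simp only [Matrix.of_apply, hadj, Matrix.diagonal_apply]
      by_cases h : v = r
      · subst h; simp [eq_comm]
      · simp [h]
    have hprod : ∀ g : A → ℚ, ∏ i, g i = g ρ := fun g => by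
      apply Fintype.prod_eq_single
      intro x hx; exact absurd (Subsingleton.elim _ _) hx
    rw [hmat, Matrix.det_diagonal, ← Finset.mul_prod_erase _ _ (Finset.mem_univ r)]
    have h1 : ∏ v ∈ Finset.univ.erase r, (if v = r then (1:ℚ) else 0) = 0 ^ (n ρ - 1) := by
      rw [Finset.prod_congr rfl (g := fun _ => 0)
        (fun v hv => by rw [if_neg (Finset.ne_of_mem_erase hv)]), Finset.prod_const,
        Finset.card_erase_of_mem (Finset.mem_univ r), ← hn ρ]
      congr 3
      ext v; simp [Subsingleton.elim (a v) ρ]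
    rw [h1]
    simp only [hprod, hnb]
    have := hpos ρ
    rcases Nat.lt_or_ge 1 (n ρ) with h | h
    · have : n ρ - 1 ≠ 0 := by omega
      simp [this]
    · have : n ρ = 1 := by omega
      simp [this]
  have hd0 : ∀ i, ∑ x, (if T.Adj i x then (n x : ℚ) else 0) =
      ∑ j ∈ T.neighborFinset i, (n j : ℚ) := by
    intro i
    rw [SimpleGraph.neighborFinset_eq_filter, Finset.sum_filter]
  set d : A → ℚ := fun i => ∑ x, (if T.Adj i x then (n x : ℚ) else 0) with hd
  have hdpos : ∀ i, d i ≠ 0 := by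
    intro i
    have : 0 < d i := by
      have hd0i : d i = ∑ j ∈ T.neighborFinset i, (n j : ℚ) := hd0 i
      rw [hd0i]
      apply Finset.sum_pos
      · intro j _; exact_mod_cast hpos j
      · rw [← Finset.card_pos]
        exact hT.connected.preconnected.degree_pos_of_nontrivial i
    exact this.ne'
  have hfib : ∀ g : A → ℚ, ∑ v, g (a v) = ∑ i, n i * g i := by
    intro g
    rw [← Finset.sum_fiberwise (s := Finset.univ) (g := a)]
    apply Finset.sum_congr rfl
    intro i _
    rw [Finset.sum_congr rfl (g := fun _ => g i)
      (fun v hv => by rw [(Finset.mem_filter.1 hv).2])]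
    simp [hn]
  have hdV : ∀ i, ∑ x, (if T.Adj i (a x) then (1:ℚ) else 0) = d i := by
    intro i
    rw [hfib (fun j => if T.Adj i j then 1 else 0), hd]
    simp
  have hfibp : ∏ v, d (a v) = ∏ i, d i ^ n i := by
    rw [← Finset.prod_fiberwise (s := Finset.univ) (g := a)]
    apply Finset.prod_congr rfl
    intro i _
    rw [Finset.prod_congr rfl (g := fun _ => d i)
      (fun v hv => by rw [(Finset.mem_filter.1 hv).2])]
    simp [hn]
  set δ : V → ℚ := fun v => if v = r then 1 else d (a v) with hδ
  let X : Matrix V A ℚ := Matrix.of fun v i => if v = r then 0 else if a v = i then (d i)⁻¹ else 0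
  let Y : Matrix A V ℚ := Matrix.of fun i v => if T.Adj i (a v) then 1 else 0
  have hK : (Matrix.of fun v u : V => if v = r then (if u = r then (1:ℚ) else 0) else
      (if v = u then ∑ x, (if T.Adj (a v) (a x) then (1:ℚ) else 0) else 0) -
        (if T.Adj (a v) (a u) then 1 else 0)) = Matrix.diagonal δ * (1 - X * Y) := by
    ext v u
    rw [Matrix.diagonal_mul, Matrix.sub_apply, Matrix.mul_apply, Matrix.one_apply]
    simp only [Matrix.of_apply, X, Y, hδ, hdV]
    by_cases h : v = r
    · subst h; simp [eq_comm]
    · have := hdpos (a v)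
      simp only [h, if_false, ite_mul, zero_mul, Finset.sum_ite_eq, Finset.mem_univ, if_true]
      by_cases h2 : v = u
      · subst h2; simp
      · simp [h2]
        field_simp
  have hM : (Matrix.of fun i j : A => (if i = j then ∑ x, (if T.Adj i x then (n x:ℚ) else 0) else 0) -
      (if T.Adj i j then (n j:ℚ) - (if j = ρ then 1 else 0) else 0)) =
      (1 - Y * X) * Matrix.diagonal d := by
    ext i j
    rw [Matrix.mul_diagonal, Matrix.sub_apply, Matrix.mul_apply, Matrix.one_apply]
    have e1 : ∑ v, Y i v * X v j =
        (if T.Adj i j then (n j:ℚ) - (if j = ρ then 1 else 0) else 0) * (d j)⁻¹ := by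
      have : ∀ v, Y i v * X v j = (if a v = j then (if T.Adj i j then (d j)⁻¹ else 0) else 0)
          - (if v = r then (if ρ = j then (if T.Adj i j then (d j)⁻¹ else 0) else 0) else 0) := by
        intro v
        simp only [X, Y, Matrix.of_apply]
        by_cases h : v = r
        · subst h; simp [har]
        · by_cases h2 : a v = j
          · simp [h, h2]
          · simp [h, h2]
      rw [Finset.sum_congr rfl fun v _ => this v, Finset.sum_sub_distrib,
        hfib (fun k => if k = j then (if T.Adj i j then (d j)⁻¹ else 0) else 0)]
      simp only [Finset.sum_ite_eq', Finset.mem_univ, if_true, mul_ite, mul_zero]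
      by_cases h : T.Adj i j
      · by_cases h2 : j = ρ
        · subst h2; simp [h]; ring
        · simp [h, h2, Ne.symm h2]
      · simp [h]
    rw [e1, sub_mul, mul_assoc, inv_mul_cancel₀ (hdpos j), mul_one, Matrix.of_apply]
    by_cases h : i = j
    · subst h; simp [hd]
    · simp [h]
  have h1 := detA T hT ρ (fun i => (n i : ℚ)) (by exact_mod_cast (hpos ρ).ne')
  rw [hM, Matrix.det_mul, Matrix.det_diagonal] at h1
  rw [hK, Matrix.det_mul, Matrix.det_diagonal, Matrix.det_one_sub_mul_comm]
  have h2 : d ρ * ∏ v, δ v = ∏ i, d i ^ n i := by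
    rw [← hfibp, ← Finset.mul_prod_erase _ δ (Finset.mem_univ r),
      ← Finset.mul_prod_erase _ (fun v => d (a v)) (Finset.mem_univ r), har]
    simp only [hδ, if_true, one_mul]
    congr 1
    apply Finset.prod_congr rfl
    intro v hv
    rw [if_neg (Finset.ne_of_mem_erase hv)]
  have h3 : ∏ i, d i ^ n i = (∏ i, d i ^ (n i - 1)) * ∏ i, d i := by
    rw [← Finset.prod_mul_distrib]
    apply Finset.prod_congr rfl
    intro i _
    rw [← pow_succ, Nat.sub_add_cancel (hpos i)]
  simp only [← hd0]
  have h4 : ∏ i, d i ≠ 0 := Finset.prod_ne_zero_iff.2 fun i _ => hdpos i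
  apply mul_left_cancel₀ (mul_ne_zero (hdpos ρ) h4)
  change _ = d ρ * (∏ i, d i) * ((∏ i, d i ^ (n i - 1)) * _)
  change _ = d ρ * _ at h1
  calc _ = (d ρ * ∏ v, δ v) * ((1 - Y * X).det * (∏ i, d i) * ∏ i, (n i : ℚ)) := by ring
    _ = _ := by rw [h1, h2, h3]; ring

open Classical in
theorem card_profile {A : Type*} [Fintype A] [DecidableEq A] (n : A → ℕ) (N : ℕ) (hN : N = ∑ i, n i) :
    (Finset.univ.filter fun a : Fin N → A =>
      ∀ i, (Finset.univ.filter fun v => a v = i).card = n i).card * ∏ i, (n i).factorial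
      = N.factorial := by
  have hcard : ∀ (a : Fin N → A) i, Fintype.card {v // a v = i} =
      (Finset.univ.filter fun v => a v = i).card := fun a i => Fintype.card_subtype _
  obtain ⟨a0, ha0⟩ : ∃ a0 : Fin N → A,
      ∀ i, (Finset.univ.filter fun v => a0 v = i).card = n i := by
    have e : Fin N ≃ Σ i, Fin (n i) := Fintype.equivOfCardEq (by simp [hN])
    refine ⟨fun v => (e v).1, fun i => ?_⟩
    rw [← hcard, ← Fintype.card_fin (n i)]
    apply Fintype.card_congr
    refine (e.subtypeEquiv (q := fun x => x.1 = i) fun v => Iff.rfl).trans ?_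
    exact Equiv.sigmaSubtype i
  have h1 := Finset.card_eq_sum_card_fiberwise (s := (Finset.univ : Finset (Equiv.Perm (Fin N))))
    (t := Finset.univ.filter fun a : Fin N → A =>
      ∀ i, (Finset.univ.filter fun v => a v = i).card = n i)
    (f := fun σ : Equiv.Perm (Fin N) => a0 ∘ σ) (by
      intro σ _
      simp only [Finset.coe_filter, Finset.mem_univ, true_and, Set.mem_ofPred_eq]
      intro i
      rw [← ha0 i, ← hcard, ← hcard]
      exact Fintype.card_congr (σ.subtypeEquiv fun v => Iff.rfl))
  rw [Finset.card_univ, Fintype.card_perm, Fintype.card_fin] at h1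
  rw [h1, Finset.sum_congr rfl (g := fun _ => ∏ i, (n i).factorial), Finset.sum_const,
    smul_eq_mul]
  intro a ha
  simp only [Finset.mem_filter, Finset.mem_univ, true_and] at ha
  let σ0 : Equiv.Perm (Fin N) := Equiv.ofFiberEquiv (f := a) (g := a0)
    (fun i => Fintype.equivOfCardEq (by rw [hcard, hcard, ha, ha0]))
  have hσ0 : ∀ v, a0 (σ0 v) = a v := fun v => Equiv.ofFiberEquiv_map _ v
  have h2 := DomMulAct.stabilizer_card a0
  simp only [hcard, ha0] at h2
  rw [← h2, ← Fintype.card_subtype]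
  apply Fintype.card_congr
  refine (Equiv.mulRight σ0⁻¹).subtypeEquiv fun σ => ?_
  simp only [Equiv.coe_mulRight, funext_iff, Function.comp_apply, Equiv.Perm.mul_apply]
  constructor
  · intro h v
    rw [h, ← hσ0]; simp
  · intro h v
    have := h (σ0 v)
    rw [hσ0] at this
    simpa using this

theorem trees_embedded_in_trees
    {A : Type*} [Fintype A] [DecidableEq A]
    (T : SimpleGraph A) [DecidableRel T.Adj] (hT : T.IsTree) (ρ : A)
    (n : A → ℕ) (hpos : ∀ i, 0 < n i)
    (N : ℕ) (hN : N = ∑ i, n i) :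
    {p : SimpleGraph (Fin N) × Fin N × (Fin N → A) |
        p.1.IsTree ∧ p.2.2 p.2.1 = ρ ∧
        (∀ v w, p.1.Adj v w → T.Adj (p.2.2 v) (p.2.2 w)) ∧
        (∀ i : A, {v : Fin N | p.2.2 v = i}.ncard = n i)}.ncard
      * (∏ i, (n i).factorial) * (∏ i, n i) =
    n ρ * N.factorial *
      (∏ i, (∑ j ∈ T.neighborFinset i, n j) ^ (n i - 1)) *
      ∏ i, n i ^ (T.neighborFinset i).card := by
  classical
  have hnc : ∀ (a : Fin N → A) i, {v : Fin N | a v = i}.ncard =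
      (Finset.univ.filter fun v => a v = i).card := by
    intro a i
    rw [← Set.ncard_coe_finset]; simp
  set R : ℚ := (∏ i, (∑ j ∈ T.neighborFinset i, (n j : ℚ)) ^ (n i - 1)) *
      ∏ i, (n i : ℚ) ^ (T.neighborFinset i).card with hR
  have hτ : ∀ (a : Fin N → A) (r : Fin N), a r = ρ →
      (∀ i, (Finset.univ.filter fun v => a v = i).card = n i) →
      ((Finset.univ.filter fun G : SimpleGraph (Fin N) =>
        G.IsTree ∧ ∀ v w, G.Adj v w → T.Adj (a v) (a w)).card : ℚ) * ∏ i, (n i : ℚ) = R := by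
    intro a r har ha
    have h1 := detV T hT ρ n hpos a r har ha
    have h2 := mtt r (fun v u => if T.Adj (a v) (a u) then (1:ℚ) else 0)
    have h3 := card_trees r (T.comap a)
    simp only [SimpleGraph.comap_adj] at h3
    have h6 : ∀ G, G ≤ T.comap a ↔ ∀ v w, G.Adj v w → T.Adj (a v) (a w) := fun G => Iff.rfl
    simp only [h6] at h3
    rw [hR, ← h1, h2]
    congr 1
  have hS : {p : SimpleGraph (Fin N) × Fin N × (Fin N → A) |
        p.1.IsTree ∧ p.2.2 p.2.1 = ρ ∧
        (∀ v w, p.1.Adj v w → T.Adj (p.2.2 v) (p.2.2 w)) ∧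
        (∀ i : A, {v : Fin N | p.2.2 v = i}.ncard = n i)}.ncard =
      ∑ a ∈ (Finset.univ.filter fun a : Fin N → A =>
        ∀ i, (Finset.univ.filter fun v => a v = i).card = n i),
        ∑ r ∈ (Finset.univ.filter fun r => a r = ρ),
          (Finset.univ.filter fun G : SimpleGraph (Fin N) =>
            G.IsTree ∧ ∀ v w, G.Adj v w → T.Adj (a v) (a w)).card := by
    rw [← Finset.coe_filter_univ, Set.ncard_coe_finset, Finset.card_filter, Fintype.sum_prod_type,
      Finset.sum_comm, Fintype.sum_prod_type, Finset.sum_comm, Finset.sum_filter]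
    apply Finset.sum_congr rfl
    intro a _
    by_cases ha : ∀ i, (Finset.univ.filter fun v => a v = i).card = n i
    · rw [if_pos ha, Finset.sum_filter]
      apply Finset.sum_congr rfl
      intro r _
      by_cases hr : a r = ρ
      · rw [if_pos hr, Finset.card_filter]
        simp [hnc, ha, hr]
      · simp [hr]
    · rw [if_neg ha]
      simp only [hnc, ha, and_false, if_false, Finset.sum_const_zero]
  have hcp := card_profile n N hN
  have hprodpos : (∏ i, (n i : ℚ)) ≠ 0 :=
    Finset.prod_ne_zero_iff.2 fun i _ => by exact_mod_cast (hpos i).ne'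
  rw [hS]
  have : ∀ x y : ℕ, (x : ℚ) = y → x = y := fun x y h => by exact_mod_cast h
  apply this
  push_cast
  have h5 : ∀ a ∈ (Finset.univ.filter fun a : Fin N → A =>
        ∀ i, (Finset.univ.filter fun v => a v = i).card = n i),
        ∑ r ∈ (Finset.univ.filter fun r => a r = ρ),
          ((Finset.univ.filter fun G : SimpleGraph (Fin N) =>
            G.IsTree ∧ ∀ v w, G.Adj v w → T.Adj (a v) (a w)).card : ℚ)
        = n ρ * (R / ∏ i, (n i : ℚ)) := by
    intro a ha
    have ha := (Finset.mem_filter.1 ha).2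
    rw [Finset.sum_congr rfl (g := fun _ => R / ∏ i, (n i : ℚ)), Finset.sum_const, ha ρ,
      nsmul_eq_mul]
    intro r hr
    rw [eq_div_iff hprodpos]
    exact hτ a r (Finset.mem_filter.1 hr).2 ha
  rw [Finset.sum_congr rfl h5, Finset.sum_const, nsmul_eq_mul]
  have hcp' : ((Finset.univ.filter fun a : Fin N → A =>
      ∀ i, (Finset.univ.filter fun v => a v = i).card = n i).card : ℚ) *
      ∏ i, ((n i).factorial : ℚ) = (N.factorial : ℚ) := by
    rw [← hcp]; push_cast; congr
  rw [mul_assoc _ _ (∏ i, (n i : ℚ) ^ (T.neighborFinset i).card), ← hR, ← hcp']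
  field_simp
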